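/- arXiv:1410.3926 — 2 statements merged into one kernel-verified Lean document; each statement's English description precedes it below -/
import Mathlib

section
/- There exists f ∈ P_16, i.e. an even trigonometric polynomial f(φ) = Σ_{k=0}^{16} a_k cos(kφ) of degree 16 with all a_k ≥ 0, a_1 > a_0 > 0, and f(φ) ≥ 0 for all real φ, such that (f(0) − a_0)/(√a_1 − √a_0)² < 34.49747009. Consequently V_16 < 34.49747009. -/
/-- `P_n`: coefficient sequences of even trigonometric polynomials
`f(φ) = Σ_{k=0}^n a_k cos(kφ)` with nonnegative coefficients, `a_1 > a_0`,
which are nonnegative everywhere. -/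
def LandauSet (n : ℕ) : Set (ℕ → ℝ) :=
  {a | (∀ k ≤ n, 0 ≤ a k) ∧ a 0 < a 1 ∧
    ∀ φ : ℝ, 0 ≤ ∑ k ∈ Finset.range (n + 1), a k * Real.cos (k * φ)}

/-- The Landau ratio `(f(0) - a_0) / (√a_1 - √a_0)^2`. -/
noncomputable def landauRatio (n : ℕ) (a : ℕ → ℝ) : ℝ :=
  ((∑ k ∈ Finset.range (n + 1), a k) - a 0) /
    (Real.sqrt (a 1) - Real.sqrt (a 0)) ^ 2

/-- `V_n = inf_{f ∈ P_n} (f(0) - a_0)/(√a_1 - √a_0)^2`. -/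
noncomputable def landauV (n : ℕ) : ℝ := sInf (landauRatio n '' LandauSet n)

open Finset in
/-- The coefficients of the cosine polynomial `|Σ_{j ≤ n} c_j e^{ijφ}|²`. -/
def autocorrelation (n : ℕ) (c : ℕ → ℤ) (k : ℕ) : ℤ :=
  ∑ p ∈ range (n + 1) ×ˢ range (n + 1) with Nat.dist p.1 p.2 = k, c p.1 * c p.2

lemma Real.cos_natDist_mul (i j : ℕ) (φ : ℝ) :
    Real.cos (Nat.dist i j * φ) =
      Real.cos (i * φ) * Real.cos (j * φ) + Real.sin (i * φ) * Real.sin (j * φ) := by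
  rcases le_total i j with h | h
  · rw [Nat.dist_eq_sub_of_le h, Nat.cast_sub h, sub_mul, Real.cos_sub]
    ring
  · rw [Nat.dist_eq_sub_of_le_right h, Nat.cast_sub h, sub_mul, Real.cos_sub]

open Finset in
/-- The square-modulus identity `Σ_k r_k cos(kφ) = |Σ_j c_j e^{ijφ}|²`. -/
lemma sum_autocorrelation_mul_cos (n : ℕ) (c : ℕ → ℤ) (φ : ℝ) :
    ∑ k ∈ range (n + 1), (autocorrelation n c k : ℝ) * Real.cos (k * φ) =
      (∑ j ∈ range (n + 1), c j * Real.cos (j * φ)) ^ 2 +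
        (∑ j ∈ range (n + 1), c j * Real.sin (j * φ)) ^ 2 := by
  have hmaps : ∀ p ∈ range (n + 1) ×ˢ range (n + 1), Nat.dist p.1 p.2 ∈ range (n + 1) := by
    intro p hp
    simp only [mem_product, mem_range, Nat.dist] at hp ⊢
    omega
  have hfiber : ∀ k, (autocorrelation n c k : ℝ) * Real.cos (k * φ) =
      ∑ p ∈ range (n + 1) ×ˢ range (n + 1) with Nat.dist p.1 p.2 = k,
        (c p.1 : ℝ) * c p.2 * Real.cos (Nat.dist p.1 p.2 * φ) := by
    intro k
    rw [autocorrelation, Int.cast_sum, sum_mul]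
    refine sum_congr rfl fun p hp => ?_
    rw [(mem_filter.mp hp).2, Int.cast_mul]
  simp only [hfiber]
  rw [sum_fiberwise_of_maps_to hmaps
      (fun p : ℕ × ℕ => (c p.1 : ℝ) * c p.2 * Real.cos (Nat.dist p.1 p.2 * φ)),
    sum_product, sq, sq, sum_mul_sum, sum_mul_sum, ← sum_add_distrib]
  refine sum_congr rfl fun i _ => ?_
  rw [← sum_add_distrib]
  refine sum_congr rfl fun j _ => ?_
  rw [Real.cos_natDist_mul]
  ring

lemma autocorrelation_mem_LandauSet {n : ℕ} {c : ℕ → ℤ}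
    (hnonneg : ∀ k ≤ n, 0 ≤ autocorrelation n c k)
    (hlt : autocorrelation n c 0 < autocorrelation n c 1) :
    (fun k => (autocorrelation n c k : ℝ)) ∈ LandauSet n := by
  refine ⟨fun k hk => Int.cast_nonneg (hnonneg k hk), Int.cast_lt.mpr hlt, fun φ => ?_⟩
  rw [sum_autocorrelation_mul_cos]
  positivity

lemma landauRatio_nonneg {n : ℕ} {a : ℕ → ℝ} (ha : a ∈ LandauSet n) :
    0 ≤ landauRatio n a := by
  refine div_nonneg (sub_nonneg.mpr ?_) (sq_nonneg _)
  exact Finset.single_le_sum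
    (fun k hk => ha.1 k (Nat.lt_succ_iff.mp (Finset.mem_range.mp hk))) (by simp)

lemma landauV_le_landauRatio {n : ℕ} {a : ℕ → ℝ} (ha : a ∈ LandauSet n) :
    landauV n ≤ landauRatio n a := by
  refine csInf_le ⟨0, ?_⟩ (Set.mem_image_of_mem _ ha)
  rintro _ ⟨b, hb, rfl⟩
  exact landauRatio_nonneg hb

/-- Integer coefficients whose square modulus is a near-extremal polynomial of degree 16. -/
def landauFactor (j : ℕ) : ℤ :=
  [66065, 261709, 511787, 622773, 483417, 202883, -4832, -44569, 1058, 20339, 1289, -8024, 1482,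
    4158, -2188, -1319, 1563].getD j 0

lemma autocorrelation_landauFactor_nonneg :
    ∀ k ≤ 16, 0 ≤ autocorrelation 16 landauFactor k := by
  decide +kernel

lemma autocorrelation_landauFactor_zero :
    autocorrelation 16 landauFactor 0 = 1000000875111 := by
  decide +kernel

lemma autocorrelation_landauFactor_one :
    autocorrelation 16 landauFactor 1 = 1736607207354 := by
  decide +kernel

lemma sum_autocorrelation_landauFactor :
    ∑ k ∈ Finset.range 17, autocorrelation 16 landauFactor k = 4484191643281 := by
  decide +kernel

lemma landauRatio_landauFactor_lt :
    landauRatio 16 (fun k => (autocorrelation 16 landauFactor k : ℝ)) < 34.49747009 := by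
  have hsum : ∑ k ∈ Finset.range (16 + 1), (autocorrelation 16 landauFactor k : ℝ) =
      4484191643281 := by
    rw [← Int.cast_sum, sum_autocorrelation_landauFactor]
    norm_num
  have hzero : √(1000000875111 : ℝ) ≤ 1000000.438 := by
    rw [Real.sqrt_le_left (by norm_num)]
    norm_num
  have hone : 1317803.933 ≤ √(1736607207354 : ℝ) := by
    apply Real.le_sqrt_of_sq_le
    norm_num
  have hsq : (1317803.933 - 1000000.438 : ℝ) ^ 2 ≤ (√(1736607207354 : ℝ) - √(1000000875111 : ℝ)) ^ 2 :=
    pow_le_pow_left₀ (by norm_num) (by linarith) 2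
  rw [landauRatio, hsum, autocorrelation_landauFactor_zero, autocorrelation_landauFactor_one,
    Int.cast_ofNat, Int.cast_ofNat, div_lt_iff₀ (lt_of_lt_of_le (by norm_num) hsq)]
  norm_num at hsq ⊢
  linarith

/-- There is `f ∈ P_16` with `a_1 > a_0 > 0` whose Landau ratio is less than
`34.49747009`; consequently `V_16 < 34.49747009`. -/
theorem landau_V16 :
    (∃ a ∈ LandauSet 16, 0 < a 0 ∧ landauRatio 16 a < 34.49747009) ∧
      landauV 16 < 34.49747009 := by
  have hmem := autocorrelation_mem_LandauSet autocorrelation_landauFactor_nonneg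
    (by rw [autocorrelation_landauFactor_zero, autocorrelation_landauFactor_one]; norm_num)
  refine ⟨⟨_, hmem, ?_, landauRatio_landauFactor_lt⟩,
    (landauV_le_landauRatio hmem).trans_lt landauRatio_landauFactor_lt⟩
  simp [autocorrelation_landauFactor_zero]
end

section
/- Let d ≥ 0 and w ≥ 0 be real numbers with w·d ≤ 1.9109, and let g : ℝ → ℝ be a function such that u ↦ |g(u)|·u³ is integrable on [0, d] (hence so are |g(u)|·u^k for k = 0, 1, 2). Then ∫_0^d |g(u)| e^{wu} du ≤ M_0 + M_1·w + M_2·w²/2 + M_3·w³/3.45, where M_k = ∫_0^d |g(u)| u^k du. -/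
open MeasureTheory

/-- The remainder of the quadratic Taylor polynomial of `exp`, divided by `y ^ 3`,
is monotone on the nonnegative reals. -/
lemma pow_three_mul_exp_sub_le {y c : ℝ} (hy : 0 ≤ y) (hyc : y ≤ c) :
    c ^ 3 * (Real.exp y - (1 + y + y ^ 2 / 2)) ≤
      y ^ 3 * (Real.exp c - (1 + c + c ^ 2 / 2)) := by
  have h_tail (x : ℝ) : HasSum (fun n : ℕ => x ^ (n + 3) / (n + 3).factorial)
      (Real.exp x - (1 + x + x ^ 2 / 2)) := by
    have h : HasSum (fun n : ℕ => x ^ n / n.factorial) (Real.exp x) := by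
      rw [Real.exp_eq_exp_ℝ]
      exact NormedSpace.expSeries_div_hasSum_exp x
    simpa [Finset.sum_range_succ] using (hasSum_nat_add_iff' 3).mpr h
  refine hasSum_le (fun n => ?_) ((h_tail y).mul_left (c ^ 3)) ((h_tail c).mul_left (y ^ 3))
  have hc : 0 ≤ c := hy.trans hyc
  calc c ^ 3 * (y ^ (n + 3) / (n + 3).factorial)
      = y ^ 3 * (c ^ 3 * y ^ n / (n + 3).factorial) := by ring
    _ ≤ y ^ 3 * (c ^ 3 * c ^ n / (n + 3).factorial) := by gcongr
    _ = y ^ 3 * (c ^ (n + 3) / (n + 3).factorial) := by ring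

lemma exp_decimal_le : Real.exp 1.9109 ≤ 6.75918 := by
  have h := Real.exp_bound' (x := 0.95545) (by norm_num) (by norm_num) (n := 12) (by norm_num)
  have h_half : Real.exp 0.95545 ≤ 2.599842 := by
    refine h.trans ?_
    norm_num [Finset.sum_range_succ, Nat.factorial]
  calc Real.exp 1.9109 = Real.exp 0.95545 ^ 2 := by rw [← Real.exp_nat_mul]; norm_num
    _ ≤ 2.599842 ^ 2 := by gcongr
    _ ≤ 6.75918 := by norm_num

lemma exp_le_cubic {y : ℝ} (hy : 0 ≤ y) (hyc : y ≤ 1.9109) :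
    Real.exp y ≤ 1 + y + y ^ 2 / 2 + y ^ 3 / 3.45 := by
  have h := pow_three_mul_exp_sub_le hy hyc
  have h_top : Real.exp 1.9109 - (1 + 1.9109 + 1.9109 ^ 2 / 2) ≤ 1.9109 ^ 3 / 3.45 := by
    have := exp_decimal_le
    norm_num at this ⊢
    linarith
  have h_mul := mul_le_mul_of_nonneg_left h_top (pow_nonneg hy 3)
  have h_div : Real.exp y - (1 + y + y ^ 2 / 2) ≤ y ^ 3 / 3.45 := by
    refine le_of_mul_le_mul_left (a := (1.9109 : ℝ) ^ 3) ?_ (by norm_num)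
    calc _ ≤ _ := h
      _ ≤ _ := h_mul
      _ = _ := by ring
  linarith

/-- If `0 ≤ d`, `0 ≤ w`, `w d ≤ 1.9109` and `u ↦ |g(u)| u^k` is integrable on
`[0, d]` for `k = 0, 1, 2, 3`, then
`∫_0^d |g(u)| e^{wu} du ≤ M_0 + M_1 w + M_2 w²/2 + M_3 w³/3.45`
where `M_k = ∫_0^d |g(u)| u^k du`. -/
theorem integral_abs_mul_exp_le (d w : ℝ) (hd : 0 ≤ d) (hw : 0 ≤ w)
    (hwd : w * d ≤ 1.9109) (g : ℝ → ℝ)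
    (hint : ∀ k : ℕ, k ≤ 3 →
      IntegrableOn (fun u => |g u| * u ^ k) (Set.Icc 0 d)) :
    ∫ u in Set.Icc (0 : ℝ) d, |g u| * Real.exp (w * u) ≤
      (∫ u in Set.Icc (0 : ℝ) d, |g u| * u ^ 0) +
        (∫ u in Set.Icc (0 : ℝ) d, |g u| * u ^ 1) * w +
        (∫ u in Set.Icc (0 : ℝ) d, |g u| * u ^ 2) * w ^ 2 / 2 +
        (∫ u in Set.Icc (0 : ℝ) d, |g u| * u ^ 3) * w ^ 3 / 3.45 := by
  have h0 := hint 0 (by norm_num)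
  have h1 := (hint 1 (by norm_num)).mul_const w
  have h2 := ((hint 2 (by norm_num)).mul_const (w ^ 2)).div_const 2
  have h3 := ((hint 3 le_rfl).mul_const (w ^ 3)).div_const 3.45
  have h01 := Integrable.fun_add h0 h1
  have h012 := h01.fun_add h2
  rw [← integral_mul_const, ← integral_mul_const, ← integral_mul_const, ← integral_div,
    ← integral_div, ← integral_add h0 h1, ← integral_add h01 h2, ← integral_add h012 h3]
  refine integral_mono_of_nonneg (.of_forall fun u => by positivity)
    (h012.add h3) ?_
  refine (ae_restrict_iff' measurableSet_Icc).mpr (.of_forall fun u hu => ?_)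
  have h_exp := exp_le_cubic (mul_nonneg hw hu.1)
    ((mul_le_mul_of_nonneg_left hu.2 hw).trans hwd)
  calc |g u| * Real.exp (w * u)
      ≤ |g u| * (1 + w * u + (w * u) ^ 2 / 2 + (w * u) ^ 3 / 3.45) := by gcongr
    _ = |g u| * u ^ 0 + |g u| * u ^ 1 * w + |g u| * u ^ 2 * w ^ 2 / 2 +
        |g u| * u ^ 3 * w ^ 3 / 3.45 := by ring
end
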